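/- Suppose the pair (L,σ) is normalised, where L ⊆ V^P is an isotropic subspace free of zero, trivial, and Bell factors. Then for every contiguity class S ∈ 𝒮 the torus {(g_p)_{p∈S} ∈ (C_z)^S : Π_{s∈S} g_s = 1 if S is protected} (with no constraint if S is of gauge type), embedded in SO(3)^P by the identity at all qubits outside S, is contained in A(L,σ). -/

import Mathlib

/- Common framework: binary stabilizer codes, local unitary/SO(3) automorphism groups. -/

noncomputable section
open scoped Matrix Real ComplexConjugate
open scoped Classical

namespace Stab

/-- The one-qubit phase space `V = 𝔽₂ ⊕ 𝔽₂`, with first coordinate the `z`-component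
and second coordinate the `x`-component. -/
abbrev V : Type := ZMod 2 × ZMod 2

/-- The symplectic form on `V`. -/
def omegaV (u v : V) : ZMod 2 := u.1 * v.2 + u.2 * v.1

/-- The phase space `V^P` over a set of qubits `P`. -/
abbrev QV (P : Type) := P → V

variable {P : Type} [Fintype P] [DecidableEq P]

/-- The direct-sum symplectic form on `V^P`. -/
def omega (u v : QV P) : ZMod 2 := ∑ p, omegaV (u p) (v p)

/-- A subspace `L ⊆ V^P` is isotropic if `ω` vanishes identically on `L × L`. -/
def Isotropic (L : Submodule (ZMod 2) (QV P)) : Prop := ∀ u ∈ L, ∀ v ∈ L, omega u v = 0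

/-- Support of a vector of `V^P`. -/
def supp (v : QV P) : Set P := {p | v p ≠ 0}

/-- The basis vector `z_p`. -/
def zvec (p : P) : QV P := Pi.single p ((1 : ZMod 2), (0 : ZMod 2))

/-- The basis vector `x_p`. -/
def xvec (p : P) : QV P := Pi.single p ((0 : ZMod 2), (1 : ZMod 2))

/-- Restriction (coordinate projection) of a vector to a subset `S ⊆ P`. -/
def restrTo (S : Set P) (v : QV P) : QV P := fun p => if p ∈ S then v p else 0

/-- The coordinate subspace `V^S ⊆ V^P`. -/
def coordSub (S : Set P) : Submodule (ZMod 2) (QV P) where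
  carrier := {v | ∀ p ∉ S, v p = 0}
  add_mem' := by intro a b ha hb p hp; simp [Pi.add_apply, ha p hp, hb p hp]
  zero_mem' := by intro p _; rfl
  smul_mem' := by intro c a ha p hp; simp [Pi.smul_apply, ha p hp]

/-- `L_S := L ∩ V^S`. -/
def LS (L : Submodule (ZMod 2) (QV P)) (S : Set P) : Submodule (ZMod 2) (QV P) :=
  L ⊓ coordSub S

/-- `L` splits as a direct factor on `S`, i.e. `L = L_S × L_{P∖S}`. -/
def SplitsOn (L : Submodule (ZMod 2) (QV P)) (S : Set P) : Prop :=
  ∀ v ∈ L, restrTo S v ∈ L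

/-- `L` splits off a zero factor: on some nonempty `S ⊆ P` all vectors of `L` vanish. -/
def HasZeroFactor (L : Submodule (ZMod 2) (QV P)) : Prop :=
  ∃ S : Set P, S.Nonempty ∧ ∀ v ∈ L, ∀ p ∈ S, v p = 0

/-- The qubit `p` is trivial: `L` splits off a one-dimensional factor on `{p}`. -/
def TrivialQubit (L : Submodule (ZMod 2) (QV P)) (p : P) : Prop :=
  SplitsOn L {p} ∧ ∃ v ∈ L, v ≠ 0 ∧ supp v ⊆ {p}

/-- `L` splits off a trivial factor. -/
def HasTrivialFactor (L : Submodule (ZMod 2) (QV P)) : Prop :=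
  ∃ p : P, TrivialQubit L p

/-- `L` splits off a Bell Lagrangian: an indecomposable Lagrangian direct factor on a
two-element set of qubits (all of whose nonzero vectors have full support `{p, q}`). -/
def HasBellFactor (L : Submodule (ZMod 2) (QV P)) : Prop :=
  ∃ p q : P, p ≠ q ∧ SplitsOn L {p, q} ∧
    ∃ v ∈ L, ∃ w ∈ L, v ≠ w ∧ supp v = {p, q} ∧ supp w = {p, q} ∧ supp (v + w) = {p, q}

/-- The factor `L_S` (for `S` in a partition) is indecomposable. -/
def IndecompWithin (L : Submodule (ZMod 2) (QV P)) (S : Set P) : Prop :=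
  ∀ T ⊆ S, SplitsOn L T → T = ∅ ∨ T = S

/-! ### The Hilbert space, Pauli operators and stabilizer codes -/

/-- The state space `ℋ^{⊗P} = (ℂ²)^{⊗P}`, realised concretely as functions on
computational basis labels. -/
abbrev HP (P : Type) := (P → Fin 2) → ℂ

/-- Operators on `ℋ^{⊗P}` as matrices. -/
abbrev MatP (P : Type) := Matrix (P → Fin 2) (P → Fin 2) ℂ

/-- The tensor (local) operator `⊗_{p} g_p` on `ℋ^{⊗P}`. -/
def locOp (g : P → Matrix (Fin 2) (Fin 2) ℂ) : MatP P :=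
  Matrix.of fun u w => ∏ p, g p (u p) (w p)

def sigmaX : Matrix (Fin 2) (Fin 2) ℂ := !![0, 1; 1, 0]
def sigmaY : Matrix (Fin 2) (Fin 2) ℂ := !![0, -Complex.I; Complex.I, 0]
def sigmaZ : Matrix (Fin 2) (Fin 2) ℂ := !![1, 0; 0, -1]

/-- The one-qubit Pauli operator `Z^a X^b` attached to `(a, b) ∈ V`. -/
def pauliMat (v : V) : Matrix (Fin 2) (Fin 2) ℂ := sigmaZ ^ (v.1 : ZMod 2).val * sigmaX ^ (v.2 : ZMod 2).val

/-- The Pauli (Weyl) operator attached to `v ∈ V^P`. -/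
def Wop (v : QV P) : MatP P := locOp fun p => pauliMat (v p)

/-- A group-homomorphic section `σ` over `L` of the projection from the Pauli group
`Ṽ^P` onto `V^P`: each value `σ(v)` is a unitary scalar multiple of the Pauli operator
`W(v)`, and `σ` is multiplicative on `L`. -/
structure PauliSection (L : Submodule (ZMod 2) (QV P)) where
  toFun : QV P → MatP P
  scalar : ∀ v : QV P, ∃ c : ℂ, toFun v = c • Wop v
  unitary : ∀ v : QV P, toFun v ∈ Matrix.unitaryGroup (P → Fin 2) ℂ
  mul_of_mem : ∀ u ∈ L, ∀ v ∈ L, toFun (u + v) = toFun u * toFun v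
  map_zero : toFun 0 = 1

/-- The stabilizer code `C(L, σ)`: the common fixed-point space of the stabilizer
group `σ(L)`. -/
def code (L : Submodule (ZMod 2) (QV P)) (σ : PauliSection L) : Submodule ℂ (HP P) where
  carrier := {ψ | ∀ v ∈ L, σ.toFun v *ᵥ ψ = ψ}
  add_mem' := by intro a b ha hb v hv; rw [Matrix.mulVec_add, ha v hv, hb v hv]
  zero_mem' := by intro v hv; simp
  smul_mem' := by intro c a ha v hv; rw [Matrix.mulVec_smul, ha v hv]

/-- The standard section: `σ(v) = W(v)` on `L`. -/
def StandardOn (L : Submodule (ZMod 2) (QV P)) (σ : PauliSection L) : Prop :=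
  ∀ v ∈ L, σ.toFun v = Wop v

/-! ### `SO(3)`, rotations, and the automorphism group of a code -/

/-- `3×3` real matrices. -/
abbrev Rot : Type := Matrix (Fin 3) (Fin 3) ℝ

/-- `SO(3)` as a set of `3×3` real matrices. -/
def SO3 : Set Rot := {A | A * Aᵀ = 1 ∧ A.det = 1}

/-- The ordered Pauli basis (x, y, z) of traceless Hermitian `2×2` matrices. -/
def pauliBasis : Fin 3 → Matrix (Fin 2) (Fin 2) ℂ := ![sigmaX, sigmaY, sigmaZ]

/-- The image of a unitary `u ∈ U(2)` in `SO(3)` under the adjoint action on traceless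
Hermitian operators (the identification `U(2)/S¹ = SO(3)`):
`u σ_j u† = Σ_i (adjRot u)_{ij} σ_i`. -/
def adjRot (u : Matrix (Fin 2) (Fin 2) ℂ) : Rot :=
  Matrix.of fun i j =>
    (1 / 2 : ℝ) * ((pauliBasis i * u * pauliBasis j * u.conjTranspose).trace).re

/-- Rotation about the `x`-axis by angle `θ`. -/
def rotX (θ : ℝ) : Rot := !![1, 0, 0; 0, Real.cos θ, -Real.sin θ; 0, Real.sin θ, Real.cos θ]

/-- Rotation about the `y`-axis by angle `θ`. -/
def rotY (θ : ℝ) : Rot := !![Real.cos θ, 0, Real.sin θ; 0, 1, 0; -Real.sin θ, 0, Real.cos θ]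

/-- Rotation about the `z`-axis by angle `θ`. -/
def rotZ (θ : ℝ) : Rot := !![Real.cos θ, -Real.sin θ, 0; Real.sin θ, Real.cos θ, 0; 0, 0, 1]

/-- The circle group `C_x ⊆ SO(3)` of rotations about the `x`-axis. -/
def Cx : Set Rot := Set.range rotX

/-- The circle group `C_y ⊆ SO(3)` of rotations about the `y`-axis. -/
def Cy : Set Rot := Set.range rotY

/-- The circle group `C_z ⊆ SO(3)` of rotations about the `z`-axis. -/
def Cz : Set Rot := Set.range rotZ

/-- The octahedral group: the subgroup of `SO(3)` generated by the rotations by a right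
angle about the three coordinate axes. -/
def octahedral : Set Rot :=
  (Submonoid.closure {rotX (π / 2), rotY (π / 2), rotZ (π / 2)} : Submonoid Rot)

/-- The infinite dihedral group `D_x ⊆ SO(3)`. -/
def Dx : Set Rot := (Submonoid.closure (Cx ∪ {rotZ π}) : Submonoid Rot)

/-- The infinite dihedral group `D_y ⊆ SO(3)`. -/
def Dy : Set Rot := (Submonoid.closure (Cy ∪ {rotZ π}) : Submonoid Rot)

/-- The infinite dihedral group `D_z ⊆ SO(3)`. -/
def Dz : Set Rot := (Submonoid.closure (Cz ∪ {rotX π}) : Submonoid Rot)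

/-- The automorphism group `A(L, σ) ⊆ SO(3)^P` of the stabilizer code `C(L, σ)`:
all families of rotations admitting a local unitary lift mapping the code into itself. -/
def autSet (L : Submodule (ZMod 2) (QV P)) (σ : PauliSection L) : Set (P → Rot) :=
  {g | ∃ u : P → Matrix (Fin 2) (Fin 2) ℂ,
        (∀ p, u p ∈ Matrix.unitaryGroup (Fin 2) ℂ) ∧
        (∀ p, adjRot (u p) = g p) ∧
        ∀ ψ ∈ code L σ, locOp u *ᵥ ψ ∈ code L σ}

/-- The automorphism group `A(L, σ)_p` at the qubit `p`. -/
def autSetAt (L : Submodule (ZMod 2) (QV P)) (σ : PauliSection L) (p : P) : Set Rot :=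
  (fun g => g p) '' autSet L σ

/-- The normal subgroup `Z(L, σ)` of automorphisms acting by a scalar on the code. -/
def zSet (L : Submodule (ZMod 2) (QV P)) (σ : PauliSection L) : Set (P → Rot) :=
  {g | ∃ u : P → Matrix (Fin 2) (Fin 2) ℂ,
        (∀ p, u p ∈ Matrix.unitaryGroup (Fin 2) ℂ) ∧
        (∀ p, adjRot (u p) = g p) ∧
        ∃ c : ℂ, ∀ ψ ∈ code L σ, locOp u *ᵥ ψ = c • ψ}

/-! ### Restriction to subsets of qubits -/

/-- Restriction of a phase-space vector to the qubits of `S`. -/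
def resQV (S : Set P) (v : QV P) : QV ↥S := fun s => v s

/-- Restriction as a linear map. -/
def resLin (S : Set P) : QV P →ₗ[ZMod 2] QV ↥S where
  toFun := resQV S
  map_add' := by intros; rfl
  map_smul' := by intros; rfl

/-- `L_S`, regarded as a subspace of `V^S`. -/
def LSsub (L : Submodule (ZMod 2) (QV P)) (S : Set P) : Submodule (ZMod 2) (QV ↥S) :=
  Submodule.map (resLin S) (LS L S)

/-- The extension `M ⊗ 1` to `ℋ^{⊗P}` of an operator `M` on `ℋ^{⊗S}`. -/
def extendOp (S : Set P) (M : Matrix (↥S → Fin 2) (↥S → Fin 2) ℂ) : MatP P :=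
  Matrix.of fun u w =>
    if ∀ p ∉ S, u p = w p then M (fun s => u s) (fun s => w s) else 0

/-- `σ'` is the restriction `σ|_{L_S}` of the section `σ` to `L_S`. -/
def RestrictedSection (L : Submodule (ZMod 2) (QV P)) (σ : PauliSection L) (S : Set P)
    (σ' : PauliSection (LSsub L S)) : Prop :=
  ∀ v ∈ LS L S, extendOp S (σ'.toFun (resQV S v)) = σ.toFun v

/-! ### Contiguity, protected and gauge qubits, and normal forms -/

/-- Two qubits are contiguous if they are equal or `L` contains a vector supported
exactly on the pair. -/
def Contig (L : Submodule (ZMod 2) (QV P)) (p q : P) : Prop :=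
  p = q ∨ ∃ v ∈ L, supp v = ({p, q} : Set P)

/-- The contiguity class of a qubit. -/
def contigClass (L : Submodule (ZMod 2) (QV P)) (p : P) : Set P := {q | Contig L p q}

/-- The qubit `p` is protected: the projection `L → V^{{p}}` is surjective. -/
def IsProtected (L : Submodule (ZMod 2) (QV P)) (p : P) : Prop :=
  ∀ w : V, ∃ v ∈ L, v p = w

/-- The qubit `p` is of gauge type: the projection `L → V^{{p}}` has a line as image. -/
def IsGauge (L : Submodule (ZMod 2) (QV P)) (p : P) : Prop :=
  ¬ IsProtected L p ∧ ∃ v ∈ L, v p ≠ 0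

/-- The subspace `⟨z_a + z_b : a ≠ b ∈ S⟩`. -/
def zspan (S : Set P) : Submodule (ZMod 2) (QV P) :=
  Submodule.span (ZMod 2) {w | ∃ a ∈ S, ∃ b ∈ S, a ≠ b ∧ w = zvec a + zvec b}

/-- The vector `Σ_{s ∈ S} x_s`. -/
def xsumOn (S : Set P) : QV P := S.indicator fun _ => ((0 : ZMod 2), (1 : ZMod 2))

/-- Normal form of `L` (conclusion of the normalisation lemma): every contiguity class `S`
carries either `⟨z_a + z_b⟩` or `⟨z_a + z_b⟩ + ⟨Σ_{s∈S} x_s⟩`. -/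
def NormalForm (L : Submodule (ZMod 2) (QV P)) : Prop :=
  ∀ p : P,
    LS L (contigClass L p) = zspan (contigClass L p) ∨
    LS L (contigClass L p) =
      zspan (contigClass L p) ⊔ Submodule.span (ZMod 2) {xsumOn (contigClass L p)}

/-- The pair `(L, σ)` is normalised. -/
def Normalised (L : Submodule (ZMod 2) (QV P)) (σ : PauliSection L) : Prop :=
  NormalForm L ∧
  (∀ p : P, IsGauge L p → contigClass L p = {p} → ∀ v ∈ L, (v p).2 = 0) ∧
  (∀ p : P, IsProtected L p → contigClass L p = {p} →
    connectedComponentIn (autSetAt L σ p) 1 ⊆ Cz) ∧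
  (∀ p : P, IsProtected L p → contigClass L p ≠ {p} →
    LS L (contigClass L p) = zspan (contigClass L p) →
    ∃ v ∈ L, ∀ s ∈ contigClass L p, v s = ((0 : ZMod 2), (1 : ZMod 2))) ∧
  (∀ p q : P, p ≠ q → Contig L p q →
    σ.toFun (zvec p + zvec q) = Wop (zvec p + zvec q))

/-- A local symplectic family of automorphisms of `V`. -/
def IsLocalSymp (f : P → (V ≃ₗ[ZMod 2] V)) : Prop :=
  ∀ (p : P) (u v : V), omegaV (f p u) (f p v) = omegaV u v

/-- The image of `L` under a local (symplectic) transformation. -/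
def mapL (L : Submodule (ZMod 2) (QV P)) (f : P → (V ≃ₗ[ZMod 2] V)) :
    Submodule (ZMod 2) (QV P) :=
  Submodule.map (LinearEquiv.piCongrRight f : QV P ≃ₗ[ZMod 2] QV P).toLinearMap L

/-! ### Abstract group structures carried by subsets of a monoid -/

/-- The set `s` carries the structure of a solvable group. -/
structure SolvableGroupStructure (M : Type) [Monoid M] (s : Set M) where
  G : Type
  [grp : Group G]
  solv : IsSolvable G
  f : G → M
  inj : Function.Injective f
  map_mul : ∀ a b : G, f (a * b) = f a * f b
  range_eq : Set.range f = s

/-- The quotient of the group (carried by) `A` by the normal subgroup (carried by) `Z`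
is a compact solvable topological (Lie) group. -/
structure CompactSolvableQuotientStructure (M : Type) [Monoid M] [TopologicalSpace M]
    (A Z : Set M) where
  G : Type
  [grp : Group G]
  [top : TopologicalSpace G]
  [tgrp : IsTopologicalGroup G]
  cpt : CompactSpace G
  solv : IsSolvable G
  φ : M → G
  cont : ContinuousOn φ A
  map_mul' : ∀ a ∈ A, ∀ b ∈ A, φ (a * b) = φ a * φ b
  surj : ∀ y : G, ∃ a ∈ A, φ a = y
  ker : ∀ a ∈ A, (φ a = 1 ↔ a ∈ Z)

/-! ### Logical qubits and transversally realisable gates -/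

/-- The standard hermitian inner product on a finite-dimensional function space. -/
def innerF {ι : Type} [Fintype ι] (ψ φ : ι → ℂ) : ℂ := ∑ i, (starRingEnd ℂ) (ψ i) * φ i

/-- `e` is a unitary identification of the code space with a space of logical qubits. -/
def IsUnitaryEquiv (L : Submodule (ZMod 2) (QV P)) (σ : PauliSection L) {d : ℕ}
    (e : ↥(code L σ) ≃ₗ[ℂ] HP (Fin d)) : Prop :=
  ∀ ψ φ : ↥(code L σ),
    innerF (e ψ) (e φ) = innerF (ψ : HP P) (φ : HP P)

/-- The operator acting as `w` on the logical qubit `k` and trivially elsewhere. -/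
def oneQubitOp (d : ℕ) (k : Fin d) (w : Matrix (Fin 2) (Fin 2) ℂ) : MatP (Fin d) :=
  locOp fun j => if j = k then w else 1

/-- The set of rotations in `SO(3)` induced, via the identification `e`, on a fixed
logical qubit `k` by (exactly realised) transversal gates, i.e. by elements of `A(L, σ)`. -/
def logicalSet (L : Submodule (ZMod 2) (QV P)) (σ : PauliSection L) {d : ℕ}
    (e : ↥(code L σ) ≃ₗ[ℂ] HP (Fin d)) (k : Fin d) : Set Rot :=
  {A | ∃ w ∈ Matrix.unitaryGroup (Fin 2) ℂ, adjRot w = A ∧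
        ∃ u : P → Matrix (Fin 2) (Fin 2) ℂ,
          (∀ p, u p ∈ Matrix.unitaryGroup (Fin 2) ℂ) ∧
          ∀ φ : HP (Fin d),
            locOp u *ᵥ ((e.symm φ : HP P)) = ((e.symm (oneQubitOp d k w *ᵥ φ) : HP P))}

/-! ### Reed–Muller codes -/

/-- The qubit set `P = 𝔽₂^m ∖ {0}`. -/
abbrev RMQubits (m : ℕ) := {s : Fin m → ZMod 2 // s ≠ 0}

/-- Polynomial functions on `𝔽₂^m` of degree at most `r` with zero constant term. -/
def RMspan (r m : ℕ) : Submodule (ZMod 2) ((Fin m → ZMod 2) → ZMod 2) :=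
  Submodule.span (ZMod 2)
    {f | ∃ I : Finset (Fin m), I.Nonempty ∧ I.card ≤ r ∧ f = fun s => ∏ i ∈ I, s i}

/-- The shortened Reed–Muller code `R_*(r, m) ⊆ 𝔽₂^P`. -/
def RMstar (r m : ℕ) : Submodule (ZMod 2) (RMQubits m → ZMod 2) :=
  Submodule.map (LinearMap.funLeft (ZMod 2) (ZMod 2) Subtype.val) (RMspan r m)

/-- The `z`-part of a phase-space vector. -/
def zPart {P : Type} : QV P →ₗ[ZMod 2] (P → ZMod 2) where
  toFun v := fun p => (v p).1
  map_add' := by intros; rfl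
  map_smul' := by intros; rfl

/-- The `x`-part of a phase-space vector. -/
def xPart {P : Type} : QV P →ₗ[ZMod 2] (P → ZMod 2) where
  toFun v := fun p => (v p).2
  map_add' := by intros; rfl
  map_smul' := by intros; rfl

/-- The Calderbank–Shor–Steane isotropic subspace built from the shortened Reed–Muller
codes `R_*(m−2, m)` (in the `z`-coordinates) and `R_*(1, m)` (in the `x`-coordinates). -/
def cssL (m : ℕ) : Submodule (ZMod 2) (QV (RMQubits m)) :=
  Submodule.comap zPart (RMstar (m - 2) m) ⊓ Submodule.comap xPart (RMstar 1 m)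

/-- The stabilizer state `|0⟩_S ⊗ |0⟩_T + |0⟩_S ⊗ |1⟩_T + |1⟩_S ⊗ |0⟩_T − |1⟩_S ⊗ |1⟩_T`
(with `T = Sᶜ`), written in the computational basis. -/
def bellLike (S : Set P) (p q : P) : HP P := fun u =>
  if (∀ a ∈ S, u a = u p) ∧ (∀ a ∈ Sᶜ, u a = u q) then
    ((-1 : ℂ)) ^ ((u p : Fin 2).val * (u q : Fin 2).val) else 0

theorem locOp_mul (f g : P → Matrix (Fin 2) (Fin 2) ℂ) :
    locOp f * locOp g = locOp fun p => f p * g p := by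
  ext u w
  simp only [locOp, Matrix.mul_apply, Matrix.of_apply, ← Finset.prod_mul_distrib]
  exact (Fintype.prod_sum fun p k => f p (u p) k * g p k (w p)).symm

theorem locOp_diagonal (d : P → Fin 2 → ℂ) :
    locOp (fun p => Matrix.diagonal (d p)) = Matrix.diagonal fun w => ∏ p, d p (w p) := by
  ext u w
  by_cases h : u = w
  · subst h
    simp [locOp]
  · obtain ⟨p, hp⟩ := Function.ne_iff.mp h
    rw [Matrix.diagonal_apply_ne _ h]
    exact Finset.prod_eq_zero (Finset.mem_univ p) (Matrix.diagonal_apply_ne _ hp)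

/-- The diagonal unitary `diag(1, e^{iθ})`, a lift of the rotation about the `z`-axis by `θ`. -/
def phaseMat (θ : ℝ) : Matrix (Fin 2) (Fin 2) ℂ :=
  Matrix.diagonal ![1, Complex.exp (θ * Complex.I)]

theorem phaseMat_zero : phaseMat 0 = 1 := by
  ext i j
  fin_cases i <;> fin_cases j <;> simp [phaseMat]

theorem phaseMat_mem_unitaryGroup (θ : ℝ) : phaseMat θ ∈ Matrix.unitaryGroup (Fin 2) ℂ := by
  have h : Complex.exp (θ * Complex.I) * (starRingEnd ℂ) (Complex.exp (θ * Complex.I)) = 1 := by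
    rw [Complex.mul_conj, Complex.normSq_eq_norm_sq, Complex.norm_exp_ofReal_mul_I]
    simp
  rw [Matrix.mem_unitaryGroup_iff, phaseMat, Matrix.star_eq_conjTranspose,
    Matrix.diagonal_conjTranspose, Matrix.diagonal_mul_diagonal]
  ext i j
  fin_cases i <;> fin_cases j <;> simp [h]

theorem adjRot_phaseMat (θ : ℝ) : adjRot (phaseMat θ) = rotZ θ := by
  have h := Real.cos_sq_add_sin_sq θ
  ext i j
  fin_cases i <;> fin_cases j <;>
    simp [adjRot, phaseMat, rotZ, pauliBasis, sigmaX, sigmaY, sigmaZ, Matrix.trace_fin_two,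
      Matrix.mul_apply, Fin.sum_univ_two, Matrix.diagonal_apply, Complex.exp_ofReal_mul_I_re,
      Complex.exp_ofReal_mul_I_im] <;>
    linarith

theorem rotZ_zero : rotZ 0 = 1 := by
  ext i j
  fin_cases i <;> fin_cases j <;> simp [rotZ]

theorem exp_mul_I_eq_one_of_rotZ_eq_one {θ : ℝ} (h : rotZ θ = 1) :
    Complex.exp (θ * Complex.I) = 1 := by
  have hc := congrFun (congrFun h 0) 0
  have hs := congrFun (congrFun h 1) 0
  simp only [rotZ, Matrix.of_apply, Matrix.cons_val', Matrix.cons_val_zero, Matrix.cons_val_one,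
    Matrix.one_apply_eq] at hc hs
  rw [Matrix.one_apply_ne (by decide)] at hs
  rw [Complex.exp_mul_I, ← Complex.ofReal_cos, ← Complex.ofReal_sin, hc, hs]
  simp

theorem pauliMat_of_snd_eq_zero {v : V} (hv : v.2 = 0) :
    pauliMat v = Matrix.diagonal ![1, (-1) ^ v.1.val] := by
  have hZ : sigmaZ = Matrix.diagonal ![1, -1] := by
    ext i j
    fin_cases i <;> fin_cases j <;> simp [sigmaZ]
  rw [pauliMat, hv, hZ, Matrix.diagonal_pow]
  ext i j
  fin_cases i <;> fin_cases j <;> simp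

theorem omega_zvec_add_zvec (v : QV P) {p q : P} (hpq : p ≠ q) :
    omega v (zvec p + zvec q) = (v p).2 + (v q).2 := by
  have h : ∀ r, omegaV (v r) ((zvec p + zvec q) r) =
      (if r = p then (v r).2 else 0) + (if r = q then (v r).2 else 0) := by
    intro r
    by_cases hp : r = p
    · subst hp
      simp [omegaV, zvec, hpq]
    · by_cases hq : r = q
      · subst hq
        simp [omegaV, zvec, hpq.symm]
      · simp [omegaV, zvec, hp, hq]
  simp only [omega, h, Finset.sum_add_distrib, Finset.sum_ite_eq',
    Finset.mem_univ, if_true]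

theorem NormalForm.zvec_add_zvec_mem {L : Submodule (ZMod 2) (QV P)} (h : NormalForm L)
    {p q : P} (hpq : p ≠ q) (hc : Contig L p q) : zvec p + zvec q ∈ L := by
  have hle : zspan (contigClass L p) ≤ LS L (contigClass L p) := by
    rcases h p with h | h
    · exact h.ge
    · exact le_sup_left.trans h.ge
  exact (hle (Submodule.subset_span ⟨p, Or.inl rfl, q, hc, hpq, rfl⟩)).1

/-- A vector fixed by `Z_p Z_q` is supported on basis labels with equal entries at `p`, `q`. -/
theorem eq_zero_of_Wop_zvec_add_zvec {p q : P} (hpq : p ≠ q) {ψ : HP P}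
    (hψ : Wop (zvec p + zvec q) *ᵥ ψ = ψ) {w : P → Fin 2} (hw : w p ≠ w q) : ψ w = 0 := by
  have hW : Wop (zvec p + zvec q) =
      Matrix.diagonal fun w => ∏ r, ![1, (-1) ^ ((zvec p + zvec q) r).1.val] (w r) := by
    rw [← locOp_diagonal, Wop]
    congr 1
    funext r
    refine pauliMat_of_snd_eq_zero ?_
    simp only [zvec, Pi.add_apply, Pi.single_apply]
    split_ifs <;> simp
  have h := congrFun hψ w
  have hprod : ∏ r, (![1, (-1) ^ ((zvec p + zvec q) r).1.val] : Fin 2 → ℂ) (w r) = -1 := by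
    rw [Finset.prod_eq_mul p q hpq]
    · have h1 : ((zvec p + zvec q) p).1 = 1 := by simp [zvec, hpq]
      have h2 : ((zvec p + zvec q) q).1 = 1 := by simp [zvec, hpq.symm]
      rw [h1, h2]
      generalize w p = a at *
      generalize w q = b at *
      fin_cases a <;> fin_cases b <;> simp_all [ZMod.val_one]
    · rintro r - ⟨hp, hq⟩
      have h1 : ((zvec p + zvec q) r).1 = 0 := by simp [zvec, hp, hq]
      rw [h1]
      generalize w r = a
      fin_cases a <;> simp
    · simp
    · simp
  rw [hW, Matrix.mulVec_diagonal, hprod, neg_one_mul] at h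
  exact self_eq_neg.mp h.symm

/-- At a qubit of gauge type in a normalised pair, `L` projects to multiples of `z`, and
likewise at all contiguous qubits. -/
theorem Normalised.snd_eq_zero {L : Submodule (ZMod 2) (QV P)} {σ : PauliSection L}
    (hnorm : Normalised L σ) (hL : Isotropic L) {p q : P} (hp : IsGauge L p)
    (hq : q ∈ contigClass L p) {v : QV P} (hv : v ∈ L) : (v q).2 = 0 := by
  have hcomm : ∀ r ∈ contigClass L p, ∀ v ∈ L, (v p).2 = (v r).2 := by
    intro r hr v hv
    by_cases hpr : p = r
    · rw [hpr]
    · have h := hL v hv _ (hnorm.1.zvec_add_zvec_mem hpr hr)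
      rw [omega_zvec_add_zvec v hpr] at h
      exact CharTwo.add_eq_zero.mp h
  rw [← hcomm q hq v hv]
  by_cases hS : contigClass L p = {p}
  · exact hnorm.2.1 p hp hS v hv
  · obtain ⟨r, hr, hrp⟩ : ∃ r ∈ contigClass L p, r ≠ p := by
      by_contra! h
      exact hS (Set.eq_singleton_iff_unique_mem.mpr ⟨Or.inl rfl, h⟩)
    have hz := hnorm.1.zvec_add_zvec_mem hrp.symm hr
    have hzp : (zvec p + zvec r) p = ((1, 0) : V) := by simp [zvec, hrp.symm]
    by_contra hne
    have hvp : (v p).2 = 1 := by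
      generalize (v p).2 = a at hne
      revert hne
      decide +revert
    refine hp.1 fun w => ⟨w.2 • v + (w.1 + w.2 * (v p).1) • (zvec p + zvec r),
      L.add_mem (L.smul_mem _ hv) (L.smul_mem _ hz), ?_⟩
    rw [Pi.add_apply, Pi.smul_apply, Pi.smul_apply, hzp]
    ext
    · simp only [Prod.fst_add, Prod.smul_fst, smul_eq_mul, mul_one]
      rw [add_left_comm, CharTwo.add_self_eq_zero, add_zero]
    · simp [hvp]

/-- A local diagonal operator whose phases vanish wherever `σ(L)` is not diagonal
preserves the code. -/
theorem locOp_phaseMat_mulVec_mem_code {L : Submodule (ZMod 2) (QV P)} (σ : PauliSection L)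
    (φ : P → ℝ) (h : ∀ p, φ p = 0 ∨ ∀ v ∈ L, (v p).2 = 0) {ψ : HP P} (hψ : ψ ∈ code L σ) :
    locOp (fun p => phaseMat (φ p)) *ᵥ ψ ∈ code L σ := by
  intro v hv
  have hcomm : Wop v * locOp (fun p => phaseMat (φ p)) =
      locOp (fun p => phaseMat (φ p)) * Wop v := by
    rw [Wop, locOp_mul, locOp_mul]
    congr 1
    funext p
    rcases h p with h | h
    · rw [h, phaseMat_zero, mul_one, one_mul]
    · rw [pauliMat_of_snd_eq_zero (h v hv), phaseMat, Matrix.diagonal_mul_diagonal,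
        Matrix.diagonal_mul_diagonal]
      simp only [mul_comm]
  have hψv := hψ v hv
  obtain ⟨c, hc⟩ := σ.scalar v
  rw [hc] at hψv ⊢
  rw [Matrix.mulVec_mulVec, Matrix.smul_mul, hcomm, ← Matrix.mul_smul, ← Matrix.mulVec_mulVec,
    hψv]

theorem locOp_phaseMat_mulVec_apply (φ : P → ℝ) (ψ : HP P) (w : P → Fin 2) :
    (locOp (fun p => phaseMat (φ p)) *ᵥ ψ) w =
      (∏ p, ![1, Complex.exp (φ p * Complex.I)] (w p)) * ψ w := by
  simp only [phaseMat]
  rw [locOp_diagonal, Matrix.mulVec_diagonal]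

/-- **Lemma (the torus is contained in `A(L, σ)`).** Let `(L, σ)` be normalised, `L`
free of zero, trivial, and Bell factors. Then for every contiguity class `S` the torus
`{(g_p) ∈ (C_z)^S : Π_{s∈S} g_s = 1 if S is protected}`, extended by the identity
outside `S`, is contained in `A(L, σ)`. -/
theorem torus_in_automorphisms {P : Type} [Fintype P] [DecidableEq P]
    (L : Submodule (ZMod 2) (QV P)) (hL : Isotropic L)
    (hzero : ¬ HasZeroFactor L) (htriv : ¬ HasTrivialFactor L)
    (hbell : ¬ HasBellFactor L)
    (σ : PauliSection L) (hnorm : Normalised L σ)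
    (p₀ : P) (θ : P → ℝ)
    (hprod : IsProtected L p₀ → rotZ (∑ᶠ q ∈ contigClass L p₀, θ q) = 1) :
    (fun p => if p ∈ contigClass L p₀ then rotZ (θ p) else 1) ∈ autSet L σ := by
  set S := contigClass L p₀ with hS
  let φ : P → ℝ := fun p => if p ∈ S then θ p else 0
  refine ⟨fun p => phaseMat (φ p), fun p => phaseMat_mem_unitaryGroup _, fun p => ?_,
    fun ψ hψ => ?_⟩
  · rw [adjRot_phaseMat]
    by_cases hp : p ∈ S
    · simp [φ, hp]
    · simp [φ, hp, rotZ_zero]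
  by_cases hprot : IsProtected L p₀
  · have hsum : ∑ᶠ q ∈ S, θ q = ∑ q, φ q := by
      rw [finsum_eq_sum_of_fintype]
      exact Finset.sum_congr rfl fun q _ => finsum_eq_if
    have hexp := exp_mul_I_eq_one_of_rotZ_eq_one (hsum ▸ hprod hprot)
    have hfix : locOp (fun p => phaseMat (φ p)) *ᵥ ψ = ψ := by
      funext w
      rw [locOp_phaseMat_mulVec_apply]
      by_cases hw : ∀ q ∈ S, w q = w p₀
      · have hone : ∏ p, (![1, Complex.exp (φ p * Complex.I)] : Fin 2 → ℂ) (w p) = 1 := by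
          have hcongr : ∀ p, (![1, Complex.exp (φ p * Complex.I)] : Fin 2 → ℂ) (w p) =
              (![1, Complex.exp (φ p * Complex.I)] : Fin 2 → ℂ) (w p₀) := by
            intro p
            by_cases hp : p ∈ S
            · rw [hw p hp]
            · generalize w p = a
              generalize w p₀ = b
              fin_cases a <;> fin_cases b <;> simp [φ, hp]
          simp only [hcongr]
          generalize w p₀ = a
          fin_cases a
          · simp
          · simpa [← Complex.exp_sum, ← Finset.sum_mul] using hexp
        rw [hone, one_mul]
      · push Not at hw
        obtain ⟨q, hq, hne⟩ := hw
        have hpq : p₀ ≠ q := fun h => hne (by rw [h])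
        have hfixed := hψ _ (hnorm.1.zvec_add_zvec_mem hpq hq)
        rw [hnorm.2.2.2.2 p₀ q hpq hq] at hfixed
        rw [eq_zero_of_Wop_zvec_add_zvec hpq hfixed hne.symm, mul_zero]
    rwa [hfix]
  · have hgauge : IsGauge L p₀ := by
      refine ⟨hprot, ?_⟩
      by_contra! h
      exact hzero ⟨{p₀}, Set.singleton_nonempty _, fun v hv p hp => by
        rw [Set.mem_singleton_iff.mp hp, h v hv]⟩
    refine locOp_phaseMat_mulVec_mem_code σ φ (fun p => ?_) hψ
    by_cases hp : p ∈ S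
    · exact Or.inr fun v hv => hnorm.snd_eq_zero hL hgauge hp hv
    · exact Or.inl (by simp [φ, hp])

end Stab
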